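/- Fix an integer k ≥ 2. With high probability, for every 0 ≤ i ≤ n·log n simultaneously: (i) every set S ⊆ [n] with |S| ≤ k^{400} spans at most |S| edges of F_i; (ii) every set S ⊆ [n] with k^{200} ≤ |S| ≤ 4n^{0.999} spans at most (1+10^{−10})|S| edges of F_i; (iii) if i ≥ k^{99}n then there do not exist sets S, T ⊆ [n] with n^{0.99} ≤ |S| ≤ n/k³ and |T| ≤ k|S| such that S ∪ T is connected in F_i and T equals the external neighbourhood N(S) of S in F_i; (iv) if i ≥ k^{99}n then the (k+1)-core of F_{⌊i/10⌋} has more than (1 − e^{−i/(40n)})·n vertices. -/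

import Mathlib

open Filter
open scoped Classical

/-- The vertex set of the `k`-core of the graph on `Fin n` with edge set `E`. -/
def coreSet (n : ℕ) (E : Finset (Sym2 (Fin n))) (k : ℕ) : Set (Fin n) :=
  ⋃₀ {S : Set (Fin n) | ∀ v ∈ S, k ≤ {u : Fin n | u ∈ S ∧ s(v, u) ∈ E}.ncard}

/-- The number of edges of `E` spanned by the vertex set `S`. -/
noncomputable def spanCount (n : ℕ) (E : Finset (Sym2 (Fin n)))
    (S : Finset (Fin n)) : ℕ :=
  (E.filter (fun e => ∀ v ∈ e, v ∈ S)).card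

/-- The random graph process, modelled by a uniformly random ordering `σ` of all
`N = n(n−1)/2` potential edges; `procEdges n N σ i` is the edge set of `F_i`. -/
noncomputable def procEdges (n N : ℕ) (σ : Fin N ≃ {e : Sym2 (Fin n) // ¬ e.IsDiag})
    (i : ℕ) : Finset (Sym2 (Fin n)) :=
  (Finset.univ.filter (fun j : Fin N => (j : ℕ) < i)).image (fun j => (σ j : Sym2 (Fin n)))

/-- The probability of `p` under the uniform distribution on a finite type. -/
noncomputable def unifProb {Ω : Type*} (p : Ω → Prop) : ℝ :=
  (Nat.card {ω // p ω} : ℝ) / Nat.card Ω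

lemma unifProb_eq_card_filter {Ω : Type*} [Fintype Ω] (p : Ω → Prop) [DecidablePred p] :
    unifProb p = ((Finset.univ.filter p).card : ℝ) / Fintype.card Ω := by
  rw [unifProb, Nat.card_eq_fintype_card, Nat.card_eq_fintype_card, Fintype.card_subtype]

lemma unifProb_mem {Ω : Type*} [Fintype Ω] (s : Finset Ω) :
    unifProb (fun ω => ω ∈ s) = (s.card : ℝ) / Fintype.card Ω := by
  rw [unifProb_eq_card_filter, Finset.filter_univ_mem]

lemma unifProb_mono {Ω : Type*} [Finite Ω] {p q : Ω → Prop} (h : ∀ ω, p ω → q ω) :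
    unifProb p ≤ unifProb q := by
  unfold unifProb
  gcongr
  exact Nat.card_le_card_of_injective (Subtype.map id h) (Subtype.map_injective h fun _ _ h => h)

lemma unifProb_exists_le {Ω ι : Type*} [Finite Ω] (s : Finset ι) (p : ι → Ω → Prop) :
    unifProb (fun ω => ∃ a ∈ s, p a ω) ≤ ∑ a ∈ s, unifProb (p a) := by
  have := Fintype.ofFinite Ω
  simp_rw [unifProb_eq_card_filter]
  rw [← Finset.sum_div]
  gcongr
  have : (Finset.univ.filter fun ω => ∃ a ∈ s, p a ω)
      = s.biUnion fun a => Finset.univ.filter (p a) := by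
    ext ω; simp
  rw [this]
  exact_mod_cast Finset.card_biUnion_le

lemma unifProb_exists_le_card_mul {Ω ι : Type*} [Finite Ω] (s : Finset ι)
    (p : ι → Ω → Prop) (c : ℝ) (h : ∀ a ∈ s, unifProb (p a) ≤ c) :
    unifProb (fun ω => ∃ a ∈ s, p a ω) ≤ s.card * c :=
  (unifProb_exists_le s p).trans (by simpa using Finset.sum_le_card_nsmul s _ c h)

lemma unifProb_or_le {Ω : Type*} [Finite Ω] (p q : Ω → Prop) :
    unifProb (fun ω => p ω ∨ q ω) ≤ unifProb p + unifProb q := by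
  have := Fintype.ofFinite Ω
  simp_rw [unifProb_eq_card_filter]
  rw [← add_div]
  gcongr
  rw [Finset.filter_or]
  exact_mod_cast Finset.card_union_le _ _

lemma unifProb_add_not {Ω : Type*} [Finite Ω] [Nonempty Ω] (p : Ω → Prop) :
    unifProb p + unifProb (fun ω => ¬ p ω) = 1 := by
  have := Fintype.ofFinite Ω
  simp_rw [unifProb_eq_card_filter]
  rw [← add_div, div_eq_one_iff_eq (by positivity), ← Finset.card_univ]
  exact_mod_cast Finset.card_filter_add_card_filter_not p

/-- The orderings that place all of `A` among the first `i` positions and none of `B`. -/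
noncomputable def cyl {N : ℕ} {α : Type*} [Fintype α] (i : ℕ) (A B : Finset α) :
    Finset (Fin N ≃ α) :=
  Finset.univ.filter fun σ =>
    (∀ e ∈ A, (σ.symm e : ℕ) < i) ∧ ∀ e ∈ B, i ≤ (σ.symm e : ℕ)

/-- The elements among the first `i` in the ordering `σ`. -/
noncomputable def firstElems {N : ℕ} {α : Type*} [Fintype α] (σ : Fin N ≃ α) (i : ℕ) :
    Finset α :=
  Finset.univ.filter fun e => (σ.symm e : ℕ) < i

lemma mem_cyl {N : ℕ} {α : Type*} [Fintype α] {i : ℕ} {A B : Finset α} {σ : Fin N ≃ α} :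
    σ ∈ cyl i A B ↔ A ⊆ firstElems σ i ∧ Disjoint B (firstElems σ i) := by
  simp [cyl, firstElems, Finset.subset_iff, Finset.disjoint_left]

lemma card_firstElems {N : ℕ} {α : Type*} [Fintype α] (σ : Fin N ≃ α) {i : ℕ} (hi : i ≤ N) :
    (firstElems σ i).card = i := by
  have : (firstElems σ i) = (Finset.univ.filter fun j : Fin N => (j : ℕ) < i).map σ.toEmbedding := by
    ext e; simp [firstElems]
  rw [this, Finset.card_map, Fin.card_filter_val_lt]
  exact min_eq_right hi

lemma firstElems_mono {N : ℕ} {α : Type*} [Fintype α] (σ : Fin N ≃ α) {i j : ℕ} (h : i ≤ j) :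
    firstElems σ i ⊆ firstElems σ j := by
  intro e; simp only [firstElems, Finset.mem_filter, Finset.mem_univ, true_and]; omega

lemma card_cyl_swap {N : ℕ} {α : Type*} [Fintype α] (i : ℕ) (A B A' B' : Finset α)
    (τ : Equiv.Perm α) (hA : A.map τ.toEmbedding = A') (hB : B.map τ.toEmbedding = B') :
    (cyl (N := N) i A B).card = (cyl (N := N) i A' B').card := by
  subst hA hB
  refine Finset.card_equiv (Equiv.equivCongr (Equiv.refl _) τ) fun σ => ?_
  simp only [cyl, Finset.mem_filter, Finset.mem_univ, true_and, Finset.forall_mem_map]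
  simp

lemma card_cyl_insert_left {N : ℕ} {α : Type*} [Fintype α] (hN : Fintype.card α = N) {i : ℕ}
    (hi : i ≤ N) {A B : Finset α} (hAB : Disjoint A B) {e : α} (heA : e ∉ A) (heB : e ∉ B) :
    (cyl (N := N) i (insert e A) B).card * (N - A.card - B.card)
      = (cyl (N := N) i A B).card * (i - A.card) := by
  have key := Finset.sum_card_bipartiteAbove_eq_sum_card_bipartiteBelow
    (s := (A ∪ B)ᶜ) (t := cyl (N := N) i A B) (fun e σ => (σ.symm e : ℕ) < i)
  have h1 : ∀ e' ∈ (A ∪ B)ᶜ,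
      (Finset.bipartiteAbove (fun e (σ : Fin N ≃ α) => (σ.symm e : ℕ) < i)
        (cyl (N := N) i A B) e').card = (cyl (N := N) i (insert e A) B).card := by
    intro e' he'
    simp only [Finset.mem_compl, Finset.mem_union, not_or] at he'
    have : Finset.bipartiteAbove (fun e (σ : Fin N ≃ α) => (σ.symm e : ℕ) < i)
        (cyl (N := N) i A B) e' = cyl i (insert e' A) B := by
      ext σ; simp [Finset.bipartiteAbove, cyl]; tauto
    rw [this]
    apply card_cyl_swap i _ _ _ _ (Equiv.swap e' e)
    · ext x
      simp only [Finset.mem_map_equiv, Finset.mem_insert, Equiv.symm_swap]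
      grind
    · ext x
      simp only [Finset.mem_map_equiv, Equiv.symm_swap]
      grind
  have h2 : ∀ σ ∈ cyl (N := N) i A B,
      (Finset.bipartiteBelow (fun e (σ : Fin N ≃ α) => (σ.symm e : ℕ) < i)
        ((A ∪ B)ᶜ) σ).card = i - A.card := by
    intro σ hσ
    rw [mem_cyl] at hσ
    have : Finset.bipartiteBelow (fun e (σ : Fin N ≃ α) => (σ.symm e : ℕ) < i)
        ((A ∪ B)ᶜ) σ = firstElems σ i \ A := by
      ext x
      have : x ∈ B → x ∉ firstElems σ i := fun h => Finset.disjoint_left.1 hσ.2 h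
      simp only [firstElems, Finset.bipartiteBelow, Finset.mem_filter, Finset.mem_compl,
        Finset.mem_union, Finset.mem_sdiff, Finset.mem_univ, true_and] at this ⊢
      tauto
    rw [this, Finset.card_sdiff_of_subset hσ.1, card_firstElems σ hi]
  rw [Finset.sum_congr rfl h1, Finset.sum_congr rfl h2] at key
  simp only [Finset.sum_const, smul_eq_mul, Finset.card_compl, hN,
    Finset.card_union_of_disjoint hAB] at key
  rw [Nat.sub_sub, mul_comm, key]

lemma card_cyl_insert_right {N : ℕ} {α : Type*} [Fintype α] (hN : Fintype.card α = N) {i : ℕ}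
    (hi : i ≤ N) {A B : Finset α} (hAB : Disjoint A B) {e : α} (heA : e ∉ A) (heB : e ∉ B) :
    (cyl (N := N) i A (insert e B)).card * (N - A.card - B.card)
      = (cyl (N := N) i A B).card * (N - i - B.card) := by
  have key := Finset.sum_card_bipartiteAbove_eq_sum_card_bipartiteBelow
    (s := (A ∪ B)ᶜ) (t := cyl (N := N) i A B) (fun e σ => i ≤ (σ.symm e : ℕ))
  have h1 : ∀ e' ∈ (A ∪ B)ᶜ,
      (Finset.bipartiteAbove (fun e (σ : Fin N ≃ α) => i ≤ (σ.symm e : ℕ))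
        (cyl (N := N) i A B) e').card = (cyl (N := N) i A (insert e B)).card := by
    intro e' he'
    simp only [Finset.mem_compl, Finset.mem_union, not_or] at he'
    have : Finset.bipartiteAbove (fun e (σ : Fin N ≃ α) => i ≤ (σ.symm e : ℕ))
        (cyl (N := N) i A B) e' = cyl i A (insert e' B) := by
      ext σ; simp [Finset.bipartiteAbove, cyl]; tauto
    rw [this]
    apply card_cyl_swap i _ _ _ _ (Equiv.swap e' e)
    · ext x
      simp only [Finset.mem_map_equiv, Equiv.symm_swap]
      grind
    · ext x
      simp only [Finset.mem_map_equiv, Finset.mem_insert, Equiv.symm_swap]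
      grind
  have h2 : ∀ σ ∈ cyl (N := N) i A B,
      (Finset.bipartiteBelow (fun e (σ : Fin N ≃ α) => i ≤ (σ.symm e : ℕ))
        ((A ∪ B)ᶜ) σ).card = N - i - B.card := by
    intro σ hσ
    rw [mem_cyl] at hσ
    have : Finset.bipartiteBelow (fun e (σ : Fin N ≃ α) => i ≤ (σ.symm e : ℕ))
        ((A ∪ B)ᶜ) σ = (firstElems σ i)ᶜ \ B := by
      ext x
      have := @hσ.1 x
      simp only [firstElems, Finset.bipartiteBelow, Finset.mem_filter, Finset.mem_compl,
        Finset.mem_union, Finset.mem_sdiff, Finset.mem_univ, true_and, not_lt] at this ⊢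
      grind
    rw [this, Finset.card_sdiff_of_subset, Finset.card_compl, card_firstElems σ hi, hN]
    exact Finset.subset_compl_iff_disjoint_right.2 hσ.2
  rw [Finset.sum_congr rfl h1, Finset.sum_congr rfl h2] at key
  simp only [Finset.sum_const, smul_eq_mul, Finset.card_compl, hN,
    Finset.card_union_of_disjoint hAB] at key
  rw [Nat.sub_sub, mul_comm, key]

lemma unifProb_subset_firstElems_le {N : ℕ} {α : Type*} [Fintype α] (hN : Fintype.card α = N)
    {i : ℕ} (hi : i ≤ N) (A : Finset α) :
    unifProb (fun σ : Fin N ≃ α => σ ∈ cyl i A ∅) ≤ ((i : ℝ) / N) ^ A.card := by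
  induction A using Finset.induction_on with
  | empty =>
    rw [unifProb_mem]
    simpa using div_le_one_of_le₀ (by exact_mod_cast Finset.card_le_univ _) (by positivity)
  | insert e A he ih =>
    have h := card_cyl_insert_left hN hi (Finset.disjoint_empty_right A) he (by simp)
    have hA : A.card < N := by
      rw [← hN]; exact Finset.card_lt_univ_of_notMem he
    rw [unifProb_mem] at ih ⊢
    rw [Finset.card_insert_of_notMem he, pow_succ]
    have hN0 : (0 : ℝ) < N := by exact_mod_cast (by omega : 0 < N)
    have hstep : ((cyl (N := N) i (insert e A) ∅).card : ℝ)
        ≤ (cyl (N := N) i A ∅).card * (i / N) := by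
      have hh : ((cyl (N := N) i (insert e A) ∅).card : ℝ) * ((N : ℝ) - A.card)
          = (cyl (N := N) i A ∅).card * ((i - A.card : ℕ) : ℝ) := by
        rw [← Nat.cast_sub hA.le]
        exact_mod_cast (by simpa using h)
      have hpos : (0 : ℝ) < (N : ℝ) - A.card := by
        have : (A.card : ℝ) < N := by exact_mod_cast hA
        linarith
      rw [eq_comm, ← div_eq_iff hpos.ne'] at hh
      rw [← hh, mul_div_assoc]
      refine mul_le_mul_of_nonneg_left ?_ (Nat.cast_nonneg _)
      rw [div_le_div_iff₀ hpos hN0]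
      rcases le_total A.card i with hle | hle
      · rw [Nat.cast_sub hle]
        have : (i : ℝ) ≤ N := by exact_mod_cast hi
        nlinarith [(Nat.cast_nonneg A.card : (0 : ℝ) ≤ A.card)]
      · rw [Nat.sub_eq_zero_of_le hle]
        simp only [Nat.cast_zero, zero_mul]
        positivity
    calc _ ≤ ((cyl (N := N) i A ∅).card * (i / N) : ℝ) / Fintype.card (Fin N ≃ α) := by gcongr
      _ = ((cyl (N := N) i A ∅).card : ℝ) / Fintype.card (Fin N ≃ α) * (i / N) := by ring
      _ ≤ _ := by gcongr

lemma unifProb_cyl_le {N : ℕ} {α : Type*} [Fintype α] (hN : Fintype.card α = N)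
    {i : ℕ} (hi : i ≤ N) (A B : Finset α) (hAB : Disjoint A B) :
    unifProb (fun σ : Fin N ≃ α => σ ∈ cyl i A B)
      ≤ ((i : ℝ) / N) ^ A.card * Real.exp (-(B.card * ((i : ℝ) - A.card) / N)) := by
  by_cases hAi : A.card ≤ i
  swap
  · have : cyl (N := N) i A B = ∅ := by
      rw [Finset.eq_empty_iff_forall_notMem]
      intro σ hσ
      have := Finset.card_le_card (mem_cyl.1 hσ).1
      rw [card_firstElems σ hi] at this
      exact hAi this
    rw [unifProb_mem, this]
    simp
    positivity
  induction B using Finset.induction_on with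
  | empty => simpa using unifProb_subset_firstElems_le hN hi A
  | insert e B he ih =>
    rw [Finset.disjoint_insert_right] at hAB
    have h := card_cyl_insert_right hN hi hAB.2 hAB.1 he
    specialize ih hAB.2
    have hlt : A.card + B.card < N := by
      rw [← hN, ← Finset.card_union_of_disjoint hAB.2]
      exact Finset.card_lt_univ_of_notMem (x := e) (by simp [hAB.1, he])
    rw [unifProb_mem] at ih ⊢
    have hN0 : (0 : ℝ) < N := by exact_mod_cast (by omega : 0 < N)
    have hstep : ((cyl (N := N) i A (insert e B)).card : ℝ)
        ≤ (cyl (N := N) i A B).card * Real.exp (-(((i : ℝ) - A.card) / N)) := by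
      have hcast : ((N - A.card - B.card : ℕ) : ℝ) = (N : ℝ) - A.card - B.card := by
        rw [Nat.cast_sub (by omega), Nat.cast_sub (by omega)]
      have hh : ((cyl (N := N) i A (insert e B)).card : ℝ) * ((N : ℝ) - A.card - B.card)
          = (cyl (N := N) i A B).card * ((N - i - B.card : ℕ) : ℝ) := by
        rw [← hcast]
        exact_mod_cast h
      have hpos : (0 : ℝ) < (N : ℝ) - A.card - B.card := by
        rw [← hcast]; exact_mod_cast (by omega)
      rw [eq_comm, ← div_eq_iff hpos.ne'] at hh
      rw [← hh, mul_div_assoc]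
      refine mul_le_mul_of_nonneg_left ?_ (Nat.cast_nonneg _)
      have hAi' : (A.card : ℝ) ≤ i := by exact_mod_cast hAi
      have hiN : (i : ℝ) ≤ N := by exact_mod_cast hi
      have hb0 : (0 : ℝ) ≤ B.card := by positivity
      have ha0 : (0 : ℝ) ≤ A.card := by positivity
      refine le_trans ?_ (Real.add_one_le_exp _)
      rw [div_le_iff₀ hpos]
      have hx0 : 0 ≤ ((i : ℝ) - A.card) / N := div_nonneg (by linarith) hN0.le
      have hxN : ((i : ℝ) - A.card) / N * N = i - A.card := by field_simp
      have hx1 : ((i : ℝ) - A.card) / N ≤ 1 := by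
        rw [div_le_one hN0]; linarith
      set x := ((i : ℝ) - A.card) / N
      rcases le_total B.card (N - i) with hle | hle
      · rw [Nat.cast_sub hle, Nat.cast_sub hi]
        nlinarith
      · rw [Nat.sub_eq_zero_of_le hle]
        simp only [Nat.cast_zero]
        nlinarith
    calc _ ≤ ((cyl (N := N) i A B).card * Real.exp (-(((i : ℝ) - A.card) / N)) : ℝ)
            / Fintype.card (Fin N ≃ α) := by gcongr
      _ = ((cyl (N := N) i A B).card : ℝ) / Fintype.card (Fin N ≃ α)
            * Real.exp (-(((i : ℝ) - A.card) / N)) := by ring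
      _ ≤ ((i : ℝ) / N) ^ A.card * Real.exp (-(B.card * ((i : ℝ) - A.card) / N))
            * Real.exp (-(((i : ℝ) - A.card) / N)) := by gcongr
      _ = _ := by
        rw [mul_assoc, ← Real.exp_add, Finset.card_insert_of_notMem he]
        congr 2
        push_cast
        ring

lemma card_nondiag_fin (n : ℕ) :
    Fintype.card {e : Sym2 (Fin n) // ¬ e.IsDiag} = n * (n - 1) / 2 := by
  rw [Sym2.card_subtype_not_diag, Fintype.card_fin, Nat.choose_two_right]

/-- The potential edges spanned by `S`. -/
noncomputable def insideEdges {n : ℕ} (S : Finset (Fin n)) :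
    Finset {e : Sym2 (Fin n) // ¬ e.IsDiag} :=
  Finset.univ.filter fun e => ∀ v ∈ e.1, v ∈ S

/-- The potential edges between `U` and `W`. -/
noncomputable def crossEdges {n : ℕ} (U W : Finset (Fin n)) :
    Finset {e : Sym2 (Fin n) // ¬ e.IsDiag} :=
  Finset.univ.filter fun e => ∃ x ∈ U, ∃ y ∈ W, e.1 = s(x, y)

/-- The edges joining the vertices of `U` to their images under `f`. -/
noncomputable def parentEdges {n : ℕ} (U : Finset (Fin n)) (f : Fin n → Fin n) :
    Finset {e : Sym2 (Fin n) // ¬ e.IsDiag} :=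
  Finset.univ.filter fun e => ∃ v ∈ U, e.1 = s(v, f v)

lemma mem_procEdges {n N : ℕ} (σ : Fin N ≃ {e : Sym2 (Fin n) // ¬ e.IsDiag}) (i : ℕ)
    (e : Sym2 (Fin n)) : e ∈ procEdges n N σ i ↔ ∃ h : ¬ e.IsDiag, ⟨e, h⟩ ∈ firstElems σ i := by
  simp only [procEdges, firstElems, Finset.mem_image, Finset.mem_filter, Finset.mem_univ, true_and]
  constructor
  · rintro ⟨j, hj, rfl⟩
    exact ⟨(σ j).2, by simpa using hj⟩
  · rintro ⟨h, hj⟩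
    exact ⟨_, hj, by simp⟩

lemma spanCount_procEdges {n N : ℕ} (σ : Fin N ≃ {e : Sym2 (Fin n) // ¬ e.IsDiag}) (i : ℕ)
    (S : Finset (Fin n)) :
    spanCount n (procEdges n N σ i) S = (insideEdges S ∩ firstElems σ i).card := by
  rw [spanCount, ← Finset.card_map (Function.Embedding.subtype _)]
  congr 1
  ext e
  simp only [Finset.mem_filter, mem_procEdges, Finset.mem_map, insideEdges, Finset.mem_inter,
    Finset.mem_univ, true_and, Function.Embedding.subtype_apply, Subtype.exists]
  grind

lemma card_insideEdges_le {n : ℕ} (S : Finset (Fin n)) : (insideEdges S).card ≤ S.card ^ 2 := by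
  rw [sq, ← Finset.card_product, ← Finset.card_map (Function.Embedding.subtype _)]
  refine (Finset.card_le_card ?_).trans (Finset.card_image_le (f := fun p => s(p.1, p.2)))
  intro e
  simp only [insideEdges, Finset.mem_map, Finset.mem_filter, Finset.mem_univ, true_and,
    Function.Embedding.subtype_apply, Finset.mem_image, Finset.mem_product]
  rintro ⟨⟨e, he⟩, h, rfl⟩
  induction e using Sym2.ind with
  | _ x y => exact ⟨(x, y), by simpa using h, rfl⟩

lemma card_crossEdges {n : ℕ} {U W : Finset (Fin n)} (h : Disjoint U W) :
    (crossEdges U W).card = U.card * W.card := by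
  rw [← Finset.card_product, ← Finset.card_map (Function.Embedding.subtype _)]
  have : (crossEdges U W).map (Function.Embedding.subtype _)
      = (U ×ˢ W).image fun p => s(p.1, p.2) := by
    ext e
    simp only [crossEdges, Finset.mem_map, Finset.mem_filter, Finset.mem_univ, true_and,
      Function.Embedding.subtype_apply, Finset.mem_image, Finset.mem_product]
    constructor
    · rintro ⟨e, ⟨x, hx, y, hy, he⟩, rfl⟩
      exact ⟨(x, y), ⟨hx, hy⟩, he.symm⟩
    · rintro ⟨⟨x, y⟩, ⟨hx, hy⟩, rfl⟩
      refine ⟨⟨s(x, y), ?_⟩, ⟨x, hx, y, hy, rfl⟩, rfl⟩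
      rintro (rfl : x = y)
      exact Finset.disjoint_left.1 h hx hy
  rw [this, Finset.card_image_of_injOn]
  rintro ⟨x, y⟩ h1 ⟨z, w⟩ h2 he
  simp only [Finset.coe_product, Set.mem_prod, Finset.mem_coe, Sym2.eq_iff] at h1 h2 he
  rcases he with ⟨rfl, rfl⟩ | ⟨rfl, rfl⟩
  · rfl
  · exact absurd h2.2 (Finset.disjoint_left.1 h h1.1)

lemma unifProb_exists_dense_le {n N : ℕ} (hN : n * (n - 1) / 2 = N) {i : ℕ} (hi : i ≤ N)
    (s m : ℕ) :
    unifProb (fun σ : Fin N ≃ {e : Sym2 (Fin n) // ¬ e.IsDiag} =>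
        ∃ S : Finset (Fin n), S.card = s ∧ m ≤ (insideEdges S ∩ firstElems σ i).card)
      ≤ n.choose s * ((s ^ 2).choose m * ((i : ℝ) / N) ^ m) := by
  calc _ ≤ unifProb (fun σ : Fin N ≃ {e : Sym2 (Fin n) // ¬ e.IsDiag} =>
        ∃ S ∈ Finset.powersetCard s Finset.univ, ∃ A ∈ Finset.powersetCard m (insideEdges S),
          σ ∈ cyl i A ∅) := by
        refine unifProb_mono ?_
        rintro σ ⟨S, hS, hm⟩
        obtain ⟨A, hA, hAm⟩ := Finset.exists_subset_card_eq hm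
        refine ⟨S, by simpa using hS, A, ?_, ?_⟩
        · exact Finset.mem_powersetCard.2 ⟨hA.trans Finset.inter_subset_left, hAm⟩
        · exact mem_cyl.2 ⟨hA.trans Finset.inter_subset_right, by simp⟩
    _ ≤ (Finset.powersetCard s (Finset.univ : Finset (Fin n))).card *
          ((s ^ 2).choose m * ((i : ℝ) / N) ^ m) := by
        refine unifProb_exists_le_card_mul _ _ _ fun S hS => ?_
        rw [Finset.mem_powersetCard] at hS
        refine (unifProb_exists_le_card_mul _ _ (((i : ℝ) / N) ^ m) fun A hA => ?_).trans ?_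
        · rw [← (Finset.mem_powersetCard.1 hA).2]
          exact unifProb_subset_firstElems_le ((card_nondiag_fin n).trans hN) hi A
        · gcongr
          rw [Finset.card_powersetCard, ← hS.2]
          exact Nat.choose_le_choose _ (card_insideEdges_le S)
    _ = _ := by simp

lemma unifProb_exists_sparse_cut_le {n N : ℕ} (hN : n * (n - 1) / 2 = N) {i : ℕ} (hi : i ≤ N)
    (u L : ℕ) :
    unifProb (fun σ : Fin N ≃ {e : Sym2 (Fin n) // ¬ e.IsDiag} =>
        ∃ U : Finset (Fin n), U.card = u ∧ (crossEdges U Uᶜ ∩ firstElems σ i).card ≤ L)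
      ≤ n.choose u * ∑ a ∈ Finset.range (L + 1), (u * (n - u)).choose a *
          (((i : ℝ) / N) ^ a *
            Real.exp (-(((u * (n - u) - a : ℕ) : ℝ) * ((i : ℝ) - a) / N))) := by
  calc _ ≤ unifProb (fun σ : Fin N ≃ {e : Sym2 (Fin n) // ¬ e.IsDiag} =>
        ∃ U ∈ Finset.powersetCard u Finset.univ, ∃ a ∈ Finset.range (L + 1),
          ∃ A ∈ Finset.powersetCard a (crossEdges U Uᶜ),
          σ ∈ cyl i A (crossEdges U Uᶜ \ A)) := by
        refine unifProb_mono ?_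
        rintro σ ⟨U, hU, hL⟩
        refine ⟨U, by simpa using hU, _, Finset.mem_range_succ_iff.2 hL,
          crossEdges U Uᶜ ∩ firstElems σ i, ?_, ?_⟩
        · exact Finset.mem_powersetCard.2 ⟨Finset.inter_subset_left, rfl⟩
        · refine mem_cyl.2 ⟨Finset.inter_subset_right, ?_⟩
          rw [Finset.disjoint_left]
          grind
    _ ≤ (Finset.powersetCard u (Finset.univ : Finset (Fin n))).card *
        ∑ a ∈ Finset.range (L + 1), (u * (n - u)).choose a *
          (((i : ℝ) / N) ^ a *
            Real.exp (-(((u * (n - u) - a : ℕ) : ℝ) * ((i : ℝ) - a) / N))) := by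
        refine unifProb_exists_le_card_mul _ _ _ fun U hU => ?_
        rw [Finset.mem_powersetCard] at hU
        have hB : (crossEdges U Uᶜ).card = u * (n - u) := by
          rw [card_crossEdges disjoint_compl_right, Finset.card_compl, hU.2, Fintype.card_fin]
        refine (unifProb_exists_le _ _).trans (Finset.sum_le_sum fun a _ => ?_)
        refine (unifProb_exists_le_card_mul _ _ (((i : ℝ) / N) ^ a *
            Real.exp (-(((u * (n - u) - a : ℕ) : ℝ) * ((i : ℝ) - a) / N))) fun A hA => ?_).trans ?_
        · rw [Finset.mem_powersetCard] at hA
          have := unifProb_cyl_le ((card_nondiag_fin n).trans hN) hi A (crossEdges U Uᶜ \ A)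
            Finset.disjoint_sdiff
          rwa [Finset.card_sdiff_of_subset hA.1, hB, hA.2] at this
        · rw [Finset.card_powersetCard, hB]
    _ = _ := by simp

/-- Peeling off vertices of degree less than `k + 1` one at a time. -/
lemma exists_sparse_cut_of_core_small {n N : ℕ}
    (σ : Fin N ≃ {e : Sym2 (Fin n) // ¬ e.IsDiag}) (i k u : ℕ)
    (hu : (coreSet n (procEdges n N σ i) (k + 1)).ncard + u ≤ n) :
    ∃ U : Finset (Fin n), U.card = u ∧ (crossEdges U Uᶜ ∩ firstElems σ i).card ≤ k * u := by
  induction u with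
  | zero =>
    refine ⟨∅, rfl, ?_⟩
    simp [crossEdges]
  | succ u ih =>
    obtain ⟨U, hU, hcut⟩ := ih (by omega)
    have hnot : ¬ ∀ v ∈ ((Uᶜ : Finset (Fin n)) : Set (Fin n)),
        k + 1 ≤ {w : Fin n | w ∈ ((Uᶜ : Finset (Fin n)) : Set (Fin n)) ∧
          s(v, w) ∈ procEdges n N σ i}.ncard := by
      intro h
      have hsub : ((Uᶜ : Finset (Fin n)) : Set (Fin n))
          ⊆ coreSet n (procEdges n N σ i) (k + 1) := Set.subset_sUnion_of_mem h
      have := Set.ncard_le_ncard hsub (Set.toFinite _)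
      rw [Set.ncard_coe_finset, Finset.card_compl, Fintype.card_fin] at this
      omega
    push Not at hnot
    obtain ⟨v, hv, hdeg⟩ := hnot
    have hvU : v ∉ U := by simpa using hv
    refine ⟨insert v U, by rw [Finset.card_insert_of_notMem hvU, hU], ?_⟩
    set D : Finset (Fin n) := Finset.univ.filter fun w => w ∈ Uᶜ ∧ s(v, w) ∈ procEdges n N σ i
    have hD : D.card ≤ k := by
      have : {w : Fin n | w ∈ ((Uᶜ : Finset (Fin n)) : Set (Fin n)) ∧
          s(v, w) ∈ procEdges n N σ i} = (D : Set (Fin n)) := by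
        ext w; simp [D]
      rw [this, Set.ncard_coe_finset] at hdeg
      omega
    have hsub : (crossEdges (insert v U) (insert v U)ᶜ ∩ firstElems σ i).map
          (Function.Embedding.subtype _)
        ⊆ (crossEdges U Uᶜ ∩ firstElems σ i).map (Function.Embedding.subtype _)
          ∪ D.image fun w => s(v, w) := by
      intro e he
      simp only [Finset.mem_map, Finset.mem_inter, crossEdges, Finset.mem_filter,
        Finset.mem_univ, true_and, Function.Embedding.subtype_apply, Finset.mem_compl,
        Finset.mem_insert, not_or] at he
      obtain ⟨e, ⟨⟨x, hx, y, hy, hxy⟩, hE⟩, rfl⟩ := he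
      rw [Finset.mem_union]
      rcases hx with rfl | hx
      · right
        refine Finset.mem_image.2 ⟨y, ?_, hxy.symm⟩
        simp only [D, Finset.mem_filter, Finset.mem_univ, true_and, Finset.mem_compl]
        refine ⟨hy.2, (mem_procEdges _ _ _).2 ?_⟩
        rw [← hxy]
        exact ⟨e.2, hE⟩
      · left
        refine Finset.mem_map_of_mem (Function.Embedding.subtype _) ?_
        simp only [Finset.mem_inter, crossEdges, Finset.mem_filter, Finset.mem_univ, true_and]
        exact ⟨⟨x, hx, y, by simpa using hy.2, hxy⟩, hE⟩
    have := Finset.card_le_card hsub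
    rw [Finset.card_map] at this
    refine this.trans ((Finset.card_union_le _ _).trans ?_)
    rw [Finset.card_map, mul_add, mul_one]
    exact add_le_add hcut (Finset.card_image_le.trans hD)

/-- A connected induced subgraph has a spanning tree, recorded by a parent function. -/
lemma exists_parent_function {n : ℕ} (G : SimpleGraph (Fin n)) (U : Finset (Fin n))
    (h : (G.induce (U : Set (Fin n))).Connected) :
    ∃ f ∈ Fintype.piFinset (fun v => if v ∈ U then U else {v}),
      (∀ e ∈ parentEdges U f, e.1 ∈ G.edgeSet) ∧ (parentEdges U f).card = U.card - 1 := by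
  obtain ⟨r⟩ := h.nonempty
  have hpar : ∀ v : (U : Set (Fin n)), v ≠ r → ∃ w : (U : Set (Fin n)), G.Adj v w ∧
      (G.induce (U : Set (Fin n))).dist w r < (G.induce (U : Set (Fin n))).dist v r := by
    intro v hv
    obtain ⟨p, hp⟩ := (h.preconnected v r).exists_walk_length_eq_dist
    cases p with
    | nil => exact absurd rfl hv
    | @cons _ w _ hadj q =>
      refine ⟨w, by simpa using hadj, ?_⟩
      have := SimpleGraph.dist_le q
      simp only [SimpleGraph.Walk.length_cons] at hp
      omega
  choose! g hg using hpar
  set f : Fin n → Fin n := fun v => if hv : v ∈ U then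
    (if v = r then v else (g ⟨v, hv⟩ : Fin n)) else v with hf
  have hfv : ∀ v (hv : v ∈ U), v ≠ r → f v = (g ⟨v, hv⟩ : Fin n) := by
    intro v hv hvr; simp [hf, hv, hvr]
  have hfr : f r = r := by simp [hf]
  have hset : ∀ e, e ∈ parentEdges U f ↔ ∃ v ∈ U.erase r, e.1 = s(v, f v) := by
    intro e
    simp only [parentEdges, Finset.mem_filter, Finset.mem_univ, true_and]
    constructor
    · rintro ⟨v, hv, he⟩
      refine ⟨v, Finset.mem_erase.2 ⟨?_, hv⟩, he⟩
      rintro rfl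
      apply e.2
      rw [he, hfr]
      exact rfl
    · rintro ⟨v, hv, he⟩
      exact ⟨v, (Finset.mem_erase.1 hv).2, he⟩
  have hadj : ∀ v ∈ U.erase (r : Fin n), G.Adj v (f v) := by
    intro v hv
    rw [Finset.mem_erase] at hv
    rw [hfv v hv.2 hv.1]
    exact (hg ⟨v, hv.2⟩ (fun h => hv.1 (congrArg Subtype.val h))).1
  refine ⟨f, ?_, ?_, ?_⟩
  · rw [Fintype.mem_piFinset]
    intro v
    by_cases hv : v ∈ U
    · rw [if_pos hv]
      by_cases hvr : v = r
      · rw [hvr, hfr]; simp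
      · rw [hfv v hv hvr]; simp
    · simp [hf, hv]
  · intro e he
    obtain ⟨v, hv, he⟩ := (hset e).1 he
    rw [he]
    exact hadj v hv
  · have hr : (r : Fin n) ∈ U := by simp
    rw [← Finset.card_erase_of_mem hr, ← Finset.card_map (Function.Embedding.subtype _)]
    have : (parentEdges U f).map (Function.Embedding.subtype _)
        = (U.erase r).image fun v => s(v, f v) := by
      ext e
      simp only [Finset.mem_map, hset, Function.Embedding.subtype_apply, Finset.mem_image]
      constructor
      · rintro ⟨e, ⟨v, hv, he⟩, rfl⟩
        exact ⟨v, hv, he.symm⟩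
      · rintro ⟨v, hv, rfl⟩
        exact ⟨⟨s(v, f v), fun h => (hadj v hv).ne (Sym2.mk_isDiag_iff.1 h)⟩, ⟨v, hv, rfl⟩, rfl⟩
    rw [this, Finset.card_image_of_injOn]
    intro v hv w hw hvw
    simp only [Finset.coe_erase, Set.mem_sdiff, Finset.mem_coe, Set.mem_singleton_iff] at hv hw
    rcases Sym2.eq_iff.1 hvw with ⟨h1, -⟩ | ⟨h1, h2⟩
    · exact h1
    · exfalso
      have a1 := (hg ⟨v, hv.1⟩ (fun h => hv.2 (congrArg Subtype.val h))).2
      have a2 := (hg ⟨w, hw.1⟩ (fun h => hw.2 (congrArg Subtype.val h))).2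
      rw [hfv w hw.1 hw.2] at h1
      rw [hfv v hv.1 hv.2] at h2
      have e1 : g ⟨w, hw.1⟩ = ⟨v, hv.1⟩ := Subtype.ext h1.symm
      have e2 : g ⟨v, hv.1⟩ = ⟨w, hw.1⟩ := Subtype.ext h2
      rw [e1] at a2
      rw [e2] at a1
      omega

lemma unifProb_exists_closed_connected_le {n N : ℕ} (hN : n * (n - 1) / 2 = N) {i : ℕ}
    (hi : i ≤ N) (s m : ℕ) :
    unifProb (fun σ : Fin N ≃ {e : Sym2 (Fin n) // ¬ e.IsDiag} =>
        ∃ U : Finset (Fin n), U.card = m ∧ ∃ S ⊆ U, S.card = s ∧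
          Disjoint (crossEdges S Uᶜ) (firstElems σ i) ∧
          ((SimpleGraph.fromEdgeSet (procEdges n N σ i : Set (Sym2 (Fin n)))).induce
            (U : Set (Fin n))).Connected)
      ≤ n.choose m * (2 ^ m * (m ^ m * (((i : ℝ) / N) ^ (m - 1) *
          Real.exp (-(((s * (n - m) : ℕ) : ℝ) * ((i : ℝ) - (m - 1 : ℕ)) / N))))) := by
  calc _ ≤ unifProb (fun σ : Fin N ≃ {e : Sym2 (Fin n) // ¬ e.IsDiag} =>
        ∃ U ∈ Finset.powersetCard m Finset.univ, ∃ S ∈ U.powerset.filter (fun S => S.card = s),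
          ∃ f ∈ (Fintype.piFinset (fun v => if v ∈ U then U else {v})).filter
            (fun f => (parentEdges U f).card = m - 1 ∧ ∀ v ∈ U, f v ∈ U),
          σ ∈ cyl i (parentEdges U f) (crossEdges S Uᶜ)) := by
        refine unifProb_mono ?_
        rintro σ ⟨U, hU, S, hSU, hS, hdis, hcon⟩
        obtain ⟨f, hf, hfe, hfc⟩ := exists_parent_function _ U hcon
        refine ⟨U, by simpa using hU, S, by simpa [hS] using hSU, f, ?_, ?_⟩
        · refine Finset.mem_filter.2 ⟨hf, by rw [hfc, hU], fun v hv => ?_⟩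
          have := Fintype.mem_piFinset.1 hf v
          rwa [if_pos hv] at this
        · refine mem_cyl.2 ⟨fun e he => ?_, hdis⟩
          have := hfe e he
          rw [SimpleGraph.edgeSet_fromEdgeSet] at this
          obtain ⟨_, h⟩ := (mem_procEdges _ _ _).1 (Finset.mem_coe.1 this.1)
          exact h
    _ ≤ (Finset.powersetCard m (Finset.univ : Finset (Fin n))).card *
          (2 ^ m * (m ^ m * (((i : ℝ) / N) ^ (m - 1) *
          Real.exp (-(((s * (n - m) : ℕ) : ℝ) * ((i : ℝ) - (m - 1 : ℕ)) / N))))) := by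
        refine unifProb_exists_le_card_mul _ _ _ fun U hU => ?_
        replace hU := (Finset.mem_powersetCard.1 hU).2
        refine (unifProb_exists_le_card_mul _ _ (m ^ m * (((i : ℝ) / N) ^ (m - 1) *
          Real.exp (-(((s * (n - m) : ℕ) : ℝ) * ((i : ℝ) - (m - 1 : ℕ)) / N))))
          fun S hS => ?_).trans ?_
        swap
        · gcongr
          have := Finset.card_filter_le U.powerset (fun S => S.card = s)
          rw [Finset.card_powerset, hU] at this
          exact_mod_cast this
        rw [Finset.mem_filter, Finset.mem_powerset] at hS
        refine (unifProb_exists_le_card_mul _ _ (((i : ℝ) / N) ^ (m - 1) *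
          Real.exp (-(((s * (n - m) : ℕ) : ℝ) * ((i : ℝ) - (m - 1 : ℕ)) / N)))
          fun f hf => ?_).trans ?_
        swap
        · gcongr
          have h1 := Finset.card_filter_le
            (Fintype.piFinset (fun v => if v ∈ U then U else {v}))
            (fun f => (parentEdges U f).card = m - 1 ∧ ∀ v ∈ U, f v ∈ U)
          have h2 : (Fintype.piFinset (fun v => if v ∈ U then U else {v})).card = m ^ m := by
            rw [Fintype.card_piFinset]
            simp only [apply_ite Finset.card, Finset.card_singleton]
            rw [Finset.prod_ite]
            simp [hU]
          rw [h2] at h1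
          exact_mod_cast h1
        obtain ⟨-, hfc, hfU⟩ := Finset.mem_filter.1 hf
        have hcross : (crossEdges S Uᶜ).card = s * (n - m) := by
          rw [card_crossEdges, Finset.card_compl, hS.2, hU, Fintype.card_fin]
          exact Disjoint.mono_left hS.1 disjoint_compl_right
        have := unifProb_cyl_le ((card_nondiag_fin n).trans hN) hi (parentEdges U f)
          (crossEdges S Uᶜ) ?_
        · rwa [hcross, hfc] at this
        · rw [Finset.disjoint_left]
          intro e h1 h2
          simp only [parentEdges, crossEdges, Finset.mem_filter, Finset.mem_univ, true_and,
            Finset.mem_compl] at h1 h2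
          obtain ⟨v, hv, hve⟩ := h1
          obtain ⟨x, hx, y, hy, hxy⟩ := h2
          rw [hve, Sym2.eq_iff] at hxy
          rcases hxy with ⟨-, h⟩ | ⟨h, -⟩
          · exact hy (h ▸ hfU v hv)
          · exact hy (h ▸ hv)
    _ = _ := by simp

lemma disjoint_crossEdges_of_eq_neighborhood {n N : ℕ}
    (σ : Fin N ≃ {e : Sym2 (Fin n) // ¬ e.IsDiag}) (i : ℕ) (S T : Finset (Fin n))
    (h : (↑T : Set (Fin n)) = {w : Fin n | w ∉ (↑S : Set (Fin n)) ∧ ∃ u ∈ S,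
      (SimpleGraph.fromEdgeSet (↑(procEdges n N σ i) : Set (Sym2 (Fin n)))).Adj u w}) :
    Disjoint (crossEdges S (S ∪ T)ᶜ) (firstElems σ i) := by
  rw [Finset.disjoint_left]
  intro e he hE
  simp only [crossEdges, Finset.mem_filter, Finset.mem_univ, true_and, Finset.mem_compl,
    Finset.mem_union, not_or] at he
  obtain ⟨x, hx, y, hy, hxy⟩ := he
  apply hy.2
  rw [← Finset.mem_coe, h]
  refine ⟨by simpa using hy.1, x, hx, ?_⟩
  rw [SimpleGraph.fromEdgeSet_adj]
  refine ⟨?_, fun hh => hy.1 (hh ▸ hx)⟩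
  rw [Finset.mem_coe, mem_procEdges, ← hxy]
  exact ⟨e.2, hE⟩

lemma choose_mul_pow_le (n m : ℕ) :
    (n.choose m : ℝ) * (m : ℝ) ^ m ≤ (Real.exp 1 * n) ^ m := by
  have h1 : (n.choose m : ℝ) ≤ (n : ℝ) ^ m / m.factorial := Nat.choose_le_pow_div m n
  have h2 : (m : ℝ) ^ m / m.factorial ≤ Real.exp m :=
    Real.pow_div_factorial_le_exp _ (by positivity) m
  calc (n.choose m : ℝ) * (m : ℝ) ^ m ≤ (n : ℝ) ^ m / m.factorial * (m : ℝ) ^ m := by gcongr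
    _ = (n : ℝ) ^ m * ((m : ℝ) ^ m / m.factorial) := by ring
    _ ≤ (n : ℝ) ^ m * Real.exp m := by gcongr
    _ = _ := by rw [mul_pow, ← Real.exp_nat_mul, mul_one, mul_comm]

lemma choose_le_div_pow (n m : ℕ) :
    (n.choose m : ℝ) ≤ (Real.exp 1 * n / m) ^ m := by
  rcases Nat.eq_zero_or_pos m with rfl | hm
  · simp
  · rw [div_pow, le_div_iff₀ (by positivity)]
    exact choose_mul_pow_le n m

lemma exp_one_lt_three : Real.exp 1 < 3 := by
  have := Real.exp_one_lt_d9; linarith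

lemma pow_ninetyNine_bound {k : ℕ} (hk : 2 ≤ k) {c : ℝ} (hc : (k : ℝ) ^ 99 ≤ c) :
    2 ^ 97 * (k : ℝ) ^ 2 ≤ c ∧ 2 ^ 98 * (k : ℝ) ≤ c ∧ 2 ^ 99 ≤ c := by
  have hk' : (2 : ℝ) ≤ k := by exact_mod_cast hk
  have h97 : (2 : ℝ) ^ 97 ≤ (k : ℝ) ^ 97 := by gcongr
  have h0 : (k : ℝ) ^ 99 = (k : ℝ) ^ 97 * (k : ℝ) ^ 2 := by rw [← pow_add]
  have h1 : 2 ^ 97 * (k : ℝ) ^ 2 ≤ c := by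
    refine le_trans ?_ hc
    rw [h0]
    gcongr
  refine ⟨h1, ?_, ?_⟩
  · nlinarith
  · nlinarith

lemma half_sq_le_exp {x : ℝ} (hx : 0 ≤ x) : x ^ 2 / 2 ≤ Real.exp x := by
  have := Real.quadratic_le_exp_of_nonneg hx
  linarith

lemma twentyFour_mul_pow_le_exp {k : ℕ} (hk : 2 ≤ k) {c : ℝ} (hc : (k : ℝ) ^ 99 ≤ c) :
    (8 * Real.exp 1 * c) ^ (k + 1) ≤ Real.exp (c / 4) := by
  obtain ⟨h1, -, h3⟩ := pow_ninetyNine_bound hk hc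
  have hk' : (2 : ℝ) ≤ k := by exact_mod_cast hk
  have hc0 : 0 < c := by linarith [show (0 : ℝ) < 2 ^ 99 by positivity]
  have hx : 8 * Real.exp 1 * c ≤ Real.exp (c / (4 * (k + 1))) := by
    refine le_trans ?_ (half_sq_le_exp (by positivity))
    have : 8 * Real.exp 1 * c ≤ 24 * c := by nlinarith [exp_one_lt_three]
    refine this.trans ?_
    rw [div_pow, div_div, le_div_iff₀ (by positivity)]
    have : 768 * ((k : ℝ) + 1) ^ 2 ≤ c := by nlinarith
    nlinarith
  calc _ ≤ Real.exp (c / (4 * (k + 1))) ^ (k + 1) := by gcongr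
    _ = _ := by
      rw [← Real.exp_nat_mul]
      congr 1
      push_cast
      field_simp

lemma pow_le_exp_div_fifty {k : ℕ} (hk : 2 ≤ k) {c : ℝ} (hc : (k : ℝ) ^ 99 ≤ c) :
    c ^ k ≤ Real.exp (c / 50) := by
  obtain ⟨h1, -, h3⟩ := pow_ninetyNine_bound hk hc
  have hk' : (2 : ℝ) ≤ k := by exact_mod_cast hk
  have hc0 : 0 < c := by linarith [show (0 : ℝ) < 2 ^ 99 by positivity]
  have hx : c ≤ Real.exp (c / (50 * k)) := by
    refine le_trans ?_ (half_sq_le_exp (by positivity))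
    rw [div_pow, div_div, le_div_iff₀ (by positivity)]
    have : 5000 * (k : ℝ) ^ 2 ≤ c := by nlinarith
    nlinarith
  calc _ ≤ Real.exp (c / (50 * k)) ^ k := by gcongr
    _ = _ := by
      rw [← Real.exp_nat_mul]
      congr 1
      field_simp

lemma closed_connected_bound {n N k i s m : ℕ} (hk : 2 ≤ k) (hn : 2 ≤ n)
    (hN : (N : ℝ) = n * (n - 1) / 2) (hi : (k : ℝ) ^ 99 * n ≤ i)
    (hs : 1 ≤ s) (hsn : (s : ℝ) ≤ n / (k : ℝ) ^ 3) (hsm : s ≤ m) (hm : m ≤ (k + 1) * s) :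
    (n.choose m : ℝ) * (2 ^ m * (m ^ m * (((i : ℝ) / N) ^ (m - 1) *
      Real.exp (-(((s * (n - m) : ℕ) : ℝ) * ((i : ℝ) - (m - 1 : ℕ)) / N)))))
      ≤ n * Real.exp (-s) := by
  have hk' : (2 : ℝ) ≤ k := by exact_mod_cast hk
  have hn' : (2 : ℝ) ≤ n := by exact_mod_cast hn
  have hn0 : (0 : ℝ) < n := by linarith
  have hs' : (1 : ℝ) ≤ s := by exact_mod_cast hs
  obtain ⟨c, hic⟩ : ∃ c : ℝ, (i : ℝ) = c * n := ⟨i / n, by field_simp⟩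
  have hc : (k : ℝ) ^ 99 ≤ c := by
    rw [hic] at hi; exact le_of_mul_le_mul_right hi hn0
  obtain ⟨h1, h2, h3⟩ := pow_ninetyNine_bound hk hc
  have hc4 : (100 : ℝ) ≤ c := le_trans (by norm_num) h3
  have hc0 : 0 < c := by linarith
  have hm' : (m : ℝ) ≤ (k + 1) * s := by exact_mod_cast hm
  have hmn : (m : ℝ) ≤ 3 / 8 * n := by
    refine hm'.trans ?_
    calc ((k : ℝ) + 1) * s ≤ (k + 1) * (n / (k : ℝ) ^ 3) := by gcongr
      _ = ((k + 1) / (k : ℝ) ^ 3) * n := by ring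
      _ ≤ 3 / 8 * n := by
        refine mul_le_mul_of_nonneg_right ?_ hn0.le
        rw [div_le_div_iff₀ (by positivity) (by norm_num)]
        nlinarith [sq_nonneg ((k : ℝ) - 2)]
  have hN1 : (n : ℝ) ^ 2 / 4 ≤ N := by rw [hN]; nlinarith
  have hN2 : (N : ℝ) ≤ (n : ℝ) ^ 2 / 2 := by rw [hN]; nlinarith
  have hN0 : (0 : ℝ) < N := lt_of_lt_of_le (by positivity) hN1
  have hq : (i : ℝ) / N ≤ 4 * c / n := by
    rw [hic, div_le_div_iff₀ hN0 hn0]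
    nlinarith
  have hmpos : 1 ≤ m := hs.trans hsm
  have hqpow : ((i : ℝ) / N) ^ (m - 1) ≤ n * (4 * c / n) ^ m := by
    calc ((i : ℝ) / N) ^ (m - 1) ≤ (4 * c / n) ^ (m - 1) := by gcongr
      _ ≤ n * (4 * c / n) * (4 * c / n) ^ (m - 1) := by
        refine le_mul_of_one_le_left (by positivity) ?_
        rw [mul_div_cancel₀ _ hn0.ne']
        linarith
      _ = n * (4 * c / n) ^ m := by
        rw [mul_assoc, ← pow_succ', Nat.sub_add_cancel hmpos]
  have hexp : (s : ℝ) * c / 2 ≤ ((s * (n - m) : ℕ) : ℝ) * ((i : ℝ) - (m - 1 : ℕ)) / N := by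
    have hmn' : m ≤ n := by
      have : (m : ℝ) ≤ n := by linarith
      exact_mod_cast this
    rw [le_div_iff₀ hN0]
    push_cast [Nat.cast_sub hmn', Nat.cast_sub hmpos]
    have e1 : (s : ℝ) * (5 / 8 * n) ≤ s * (n - m) := by gcongr; linarith
    have e2 : c * n / 2 ≤ (i : ℝ) - (m - 1) := by rw [hic]; nlinarith
    calc (s : ℝ) * c / 2 * N ≤ (s : ℝ) * c / 2 * (n ^ 2 / 2) := by gcongr
      _ ≤ (s * (5 / 8 * n)) * (c * n / 2) := by
        have : 0 ≤ (s : ℝ) * c * n ^ 2 := by positivity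
        nlinarith
      _ ≤ _ := by
        refine mul_le_mul e1 e2 (by positivity) (le_trans (by positivity) e1)
  have h8 : (1 : ℝ) ≤ 8 * Real.exp 1 * c := by
    nlinarith [Real.add_one_le_exp (1 : ℝ)]
  have hpow : (8 * Real.exp 1 * c) ^ m ≤ Real.exp (c / 4 * s) := by
    calc (8 * Real.exp 1 * c) ^ m ≤ (8 * Real.exp 1 * c) ^ ((k + 1) * s) :=
          pow_le_pow_right₀ h8 hm
      _ = ((8 * Real.exp 1 * c) ^ (k + 1)) ^ s := by rw [pow_mul]
      _ ≤ (Real.exp (c / 4)) ^ s := by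
        gcongr
        exact twentyFour_mul_pow_le_exp hk hc
      _ = _ := by rw [← Real.exp_nat_mul, mul_comm]
  calc _ = ((n.choose m : ℝ) * (m : ℝ) ^ m) * 2 ^ m * (((i : ℝ) / N) ^ (m - 1) *
      Real.exp (-(((s * (n - m) : ℕ) : ℝ) * ((i : ℝ) - (m - 1 : ℕ)) / N))) := by ring
    _ ≤ (Real.exp 1 * n) ^ m * 2 ^ m * ((n * (4 * c / n) ^ m) *
      Real.exp (-((s : ℝ) * c / 2))) := by
        gcongr
        exact choose_mul_pow_le n m
    _ = n * ((8 * Real.exp 1 * c) ^ m * Real.exp (-((s : ℝ) * c / 2))) := by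
        have : (8 * Real.exp 1 * c) ^ m = (Real.exp 1 * n) ^ m * 2 ^ m * (4 * c / n) ^ m := by
          rw [← mul_pow, ← mul_pow]
          congr 1
          field_simp
          ring
        rw [this]; ring
    _ ≤ n * (Real.exp (c / 4 * s) * Real.exp (-((s : ℝ) * c / 2))) := by gcongr
    _ ≤ n * Real.exp (-s) := by
        rw [← Real.exp_add]
        gcongr
        nlinarith

set_option maxHeartbeats 1000000 in
lemma sparse_cut_bound {n N k i u : ℕ} (hk : 2 ≤ k) (hn : 8 * k ≤ n)
    (hN : (N : ℝ) = n * (n - 1) / 2) (hi : (k : ℝ) ^ 99 * n ≤ i)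
    (hu : u = ⌈(n : ℝ) * Real.exp (-(i : ℝ) / (40 * n))⌉₊) :
    (n.choose u : ℝ) * ∑ a ∈ Finset.range (k * u + 1), ((u * (n - u)).choose a : ℝ) *
          ((((i / 10 : ℕ) : ℝ) / N) ^ a *
            Real.exp (-(((u * (n - u) - a : ℕ) : ℝ) * (((i / 10 : ℕ) : ℝ) - a) / N)))
      ≤ Real.exp (-u) := by
  have hk' : (2 : ℝ) ≤ k := by exact_mod_cast hk
  have hn' : 8 * (k : ℝ) ≤ n := by exact_mod_cast hn
  have hn0 : (0 : ℝ) < n := by linarith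
  obtain ⟨c, hic⟩ : ∃ c : ℝ, (i : ℝ) = c * n := ⟨i / n, by field_simp⟩
  have hc : (k : ℝ) ^ 99 ≤ c := by
    rw [hic] at hi; exact le_of_mul_le_mul_right hi hn0
  obtain ⟨h1, h2, h3⟩ := pow_ninetyNine_bound hk hc
  have hc4 : (10000 : ℝ) ≤ c := le_trans (by norm_num) h3
  have hck : 1000 * (k : ℝ) ≤ c := by
    refine le_trans ?_ h2
    gcongr
    norm_num
  have hc0 : 0 < c := by linarith
  have hexp_eq : -(i : ℝ) / (40 * n) = -(c / 40) := by rw [hic]; field_simp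
  rw [hexp_eq] at hu
  have hu_low : (n : ℝ) * Real.exp (-(c / 40)) ≤ u := by rw [hu]; exact Nat.le_ceil _
  have hu_up : (u : ℝ) < n * Real.exp (-(c / 40)) + 1 := by
    rw [hu]; exact Nat.ceil_lt_add_one (by positivity)
  have hu0 : (0 : ℝ) < u := lt_of_lt_of_le (by positivity) hu_low
  have hexp8 : Real.exp (-(c / 40)) ≤ 1 / 8 := by
    rw [Real.exp_neg, ← one_div]
    apply one_div_le_one_div_of_le (by norm_num)
    linarith [Real.add_one_le_exp (c / 40)]
  have hun : (u : ℝ) ≤ n / 4 := by nlinarith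
  have hun' : u ≤ n := by
    have : (u : ℝ) ≤ n := by linarith
    exact_mod_cast this
  have hN1 : (n : ℝ) ^ 2 / 4 ≤ N := by rw [hN]; nlinarith
  have hN2 : (N : ℝ) ≤ (n : ℝ) ^ 2 / 2 := by rw [hN]; nlinarith
  have hN0 : (0 : ℝ) < N := lt_of_lt_of_le (by positivity) hN1
  set j := i / 10 with hj
  have hj1 : (j : ℝ) ≤ i / 10 := Nat.cast_div_le
  have hj2 : (i : ℝ) / 10 - 1 ≤ j := by
    have : i ≤ 10 * j + 10 := by omega
    have : (i : ℝ) ≤ 10 * j + 10 := by exact_mod_cast this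
    linarith
  have hchoose : (n.choose u : ℝ) ≤ Real.exp ((1 + c / 40) * u) := by
    refine (choose_le_div_pow n u).trans ?_
    rw [mul_comm (1 + c / 40), Real.exp_nat_mul]
    gcongr
    rw [div_le_iff₀ hu0, Real.exp_add, mul_assoc]
    gcongr
    calc (n : ℝ) = Real.exp (c / 40) * (n * Real.exp (-(c / 40))) := by
          rw [Real.exp_neg]; field_simp
      _ ≤ _ := by gcongr
  have hterm : ∀ a ∈ Finset.range (k * u + 1), ((u * (n - u)).choose a : ℝ) *
          (((j : ℝ) / N) ^ a *
            Real.exp (-(((u * (n - u) - a : ℕ) : ℝ) * ((j : ℝ) - a) / N)))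
        ≤ (c ^ (k * u) * Real.exp (-(c / 10 * u))) * ((u : ℝ) ^ a / a.factorial) := by
    intro a ha
    have hak : a ≤ k * u := Finset.mem_range_succ_iff.1 ha
    have hak' : (a : ℝ) ≤ k * u := by exact_mod_cast hak
    have hb : ((u * (n - u) : ℕ) : ℝ) = u * (n - u) := by
      push_cast [Nat.cast_sub hun']; rfl
    have hexp : c / 10 * u ≤ ((u * (n - u) - a : ℕ) : ℝ) * ((j : ℝ) - a) / N := by
      rw [le_div_iff₀ hN0]
      have e1 : (u : ℝ) * (5 / 8 * n) ≤ ((u * (n - u) - a : ℕ) : ℝ) := by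
        have hsub : ((u * (n - u) : ℕ) : ℝ) - a ≤ ((u * (n - u) - a : ℕ) : ℝ) := by
          rw [sub_le_iff_le_add]; exact_mod_cast le_tsub_add
        rw [hb] at hsub
        refine le_trans ?_ hsub
        nlinarith
      have e2 : 8 / 100 * (c * n) ≤ (j : ℝ) - a := by
        have : (k : ℝ) * u ≤ c / 1000 * (n / 4) := by gcongr; linarith
        have : 1 ≤ c * n / 1000 := by nlinarith
        rw [hic] at hj2
        linarith
      calc c / 10 * u * N ≤ c / 10 * u * (n ^ 2 / 2) := by gcongr
        _ = (u * (5 / 8 * n)) * (8 / 100 * (c * n)) := by ring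
        _ ≤ _ := by
          refine mul_le_mul e1 e2 (by positivity) (le_trans (by positivity) e1)
    have hbq : ((u * (n - u) : ℕ) : ℝ) * ((j : ℝ) / N) ≤ c * u := by
      have hq : (j : ℝ) / N ≤ c / n := by
        rw [div_le_div_iff₀ hN0 hn0]
        rw [hic] at hj1
        nlinarith
      calc ((u * (n - u) : ℕ) : ℝ) * ((j : ℝ) / N) ≤ (u * n) * (c / n) := by
            gcongr
            rw [hb]
            gcongr
            linarith
        _ = c * u := by field_simp
    calc _ ≤ (((u * (n - u) : ℕ) : ℝ) ^ a / a.factorial) *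
          (((j : ℝ) / N) ^ a * Real.exp (-(c / 10 * u))) := by
          gcongr
          exact Nat.choose_le_pow_div _ _
      _ = ((((u * (n - u) : ℕ) : ℝ) * ((j : ℝ) / N)) ^ a / a.factorial) *
            Real.exp (-(c / 10 * u)) := by ring
      _ ≤ ((c * u) ^ a / a.factorial) * Real.exp (-(c / 10 * u)) := by gcongr
      _ = (c ^ a * Real.exp (-(c / 10 * u))) * ((u : ℝ) ^ a / a.factorial) := by ring
      _ ≤ _ := by
        have hca : c ^ a ≤ c ^ (k * u) := pow_le_pow_right₀ (by linarith) hak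
        exact mul_le_mul_of_nonneg_right (mul_le_mul_of_nonneg_right hca (Real.exp_pos _).le)
          (by positivity)
  calc _ ≤ Real.exp ((1 + c / 40) * u) * ((c ^ (k * u) * Real.exp (-(c / 10 * u))) *
        Real.exp u) := by
        refine mul_le_mul hchoose ?_ (Finset.sum_nonneg fun _ _ => by positivity) (by positivity)
        refine (Finset.sum_le_sum hterm).trans ?_
        rw [← Finset.mul_sum]
        gcongr
        exact Real.sum_le_exp_of_nonneg hu0.le _
    _ ≤ Real.exp ((1 + c / 40) * u) * ((Real.exp (c / 50 * u) * Real.exp (-(c / 10 * u))) *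
        Real.exp u) := by
        gcongr
        rw [pow_mul, mul_comm (c / 50), Real.exp_nat_mul]
        gcongr
        exact pow_le_exp_div_fifty hk hc
    _ ≤ _ := by
        rw [← Real.exp_add, ← Real.exp_add, ← Real.exp_add]
        gcongr
        nlinarith

lemma dense_bound {n N M s m : ℕ} {δ : ℝ} (hδ : 0 < δ) (hn : 2 ≤ n)
    (hN : (N : ℝ) = n * (n - 1) / 2) (hM : (M : ℝ) ≤ n * Real.log n) (hs : 1 ≤ s)
    (hsn : (s : ℝ) ≤ 4 * (n : ℝ) ^ (0.999 : ℝ)) (hm : (1 + δ) * s ≤ m)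
    (hlarge : 4 * Real.exp 1 * Real.log n * (4 * (n : ℝ) ^ (-0.001 : ℝ)) ≤ 1) :
    (n.choose s : ℝ) * ((s ^ 2).choose m * ((M : ℝ) / N) ^ m)
      ≤ (Real.exp 1 * (4 * Real.exp 1 * Real.log n) ^ (1 + δ)
          * (4 * (n : ℝ) ^ (-0.001 : ℝ)) ^ δ) ^ s := by
  have hn' : (2 : ℝ) ≤ n := by exact_mod_cast hn
  have hn0 : (0 : ℝ) < n := by linarith
  have hs' : (1 : ℝ) ≤ s := by exact_mod_cast hs
  have hs0 : (0 : ℝ) < s := by linarith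
  have hL : 0 ≤ Real.log n := Real.log_nonneg (by linarith)
  have hN1 : (n : ℝ) ^ 2 / 4 ≤ N := by rw [hN]; nlinarith
  have hN0 : (0 : ℝ) < N := lt_of_lt_of_le (by positivity) hN1
  have hq : (M : ℝ) / N ≤ 4 * Real.log n / n := by
    rw [div_le_div_iff₀ hN0 hn0]
    calc (M : ℝ) * n ≤ (n * Real.log n) * n := by gcongr
      _ = 4 * Real.log n * (n ^ 2 / 4) := by ring
      _ ≤ _ := by gcongr
  have hsm : (s : ℝ) ≤ m := by nlinarith
  have hm0 : (0 : ℝ) < m := by linarith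
  have hratio : (s : ℝ) / n ≤ 4 * (n : ℝ) ^ (-0.001 : ℝ) := by
    rw [div_le_iff₀ hn0, mul_assoc]
    refine hsn.trans_eq ?_
    congr 1
    nth_rewrite 3 [← Real.rpow_one (n : ℝ)]
    rw [← Real.rpow_add hn0]
    norm_num
  set x : ℝ := 4 * Real.exp 1 * Real.log n * (s / n) with hx
  have hx0 : 0 ≤ x := by positivity
  have hx1 : x ≤ 1 := le_trans (by rw [hx]; gcongr) hlarge
  have hA : ((s ^ 2).choose m : ℝ) * ((M : ℝ) / N) ^ m ≤ x ^ m := by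
    calc ((s ^ 2).choose m : ℝ) * ((M : ℝ) / N) ^ m
        ≤ (Real.exp 1 * ((s ^ 2 : ℕ) : ℝ) / m) ^ m * (4 * Real.log n / n) ^ m := by
          gcongr
          exact choose_le_div_pow _ _
      _ ≤ (Real.exp 1 * s) ^ m * (4 * Real.log n / n) ^ m := by
          gcongr
          rw [div_le_iff₀ hm0]
          push_cast
          rw [sq, ← mul_assoc]
          gcongr
      _ = x ^ m := by
          rw [← mul_pow, hx]; congr 1; ring
  have hB : x ^ m ≤ (x ^ (1 + δ)) ^ s := by
    rw [← Real.rpow_natCast x m, ← Real.rpow_natCast (x ^ (1 + δ)) s, ← Real.rpow_mul hx0]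
    rcases hx0.eq_or_lt with h | h
    · rw [← h, Real.zero_rpow hm0.ne', Real.zero_rpow (by positivity)]
    · exact Real.rpow_le_rpow_of_exponent_ge h hx1 hm
  calc _ ≤ (Real.exp 1 * n / s) ^ s * (x ^ (1 + δ)) ^ s := by
        gcongr
        · exact choose_le_div_pow n s
        · exact hA.trans hB
    _ = (Real.exp 1 * (4 * Real.exp 1 * Real.log n) ^ (1 + δ) * ((s : ℝ) / n) ^ δ) ^ s := by
        rw [← mul_pow]
        congr 1
        rw [hx, Real.mul_rpow (by positivity) (by positivity),
          Real.rpow_add (by positivity : (0 : ℝ) < s / n), Real.rpow_one]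
        field_simp
    _ ≤ _ := by gcongr

lemma small_dense_bound {n N M s : ℕ} (hn : 2 ≤ n)
    (hN : (N : ℝ) = n * (n - 1) / 2) (hM : (M : ℝ) ≤ n * Real.log n) :
    (n.choose s : ℝ) * ((s ^ 2).choose (s + 1) * ((M : ℝ) / N) ^ (s + 1))
      ≤ 2 ^ (s ^ 2) * 4 ^ (s + 1) * (Real.log n ^ (s + 1) / n) := by
  have hn' : (2 : ℝ) ≤ n := by exact_mod_cast hn
  have hn0 : (0 : ℝ) < n := by linarith
  have hL : 0 ≤ Real.log n := Real.log_nonneg (by linarith)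
  have hN1 : (n : ℝ) ^ 2 / 4 ≤ N := by rw [hN]; nlinarith
  have hN0 : (0 : ℝ) < N := lt_of_lt_of_le (by positivity) hN1
  have hq : (M : ℝ) / N ≤ 4 * Real.log n / n := by
    rw [div_le_div_iff₀ hN0 hn0]
    calc (M : ℝ) * n ≤ (n * Real.log n) * n := by gcongr
      _ = 4 * Real.log n * (n ^ 2 / 4) := by ring
      _ ≤ _ := by gcongr
  calc _ ≤ (n : ℝ) ^ s * (2 ^ (s ^ 2) * (4 * Real.log n / n) ^ (s + 1)) := by
        gcongr
        · exact_mod_cast Nat.choose_le_pow n s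
        · exact_mod_cast Nat.choose_le_two_pow _ _
    _ = _ := by
        rw [div_pow, mul_pow, pow_succ (n : ℝ)]
        field_simp

lemma cast_half_mul_pred {n N : ℕ} (hN : n * (n - 1) / 2 = N) (hn : 2 ≤ n) :
    (N : ℝ) = n * (n - 1) / 2 := by
  rw [← hN, Nat.cast_div (even_iff_two_dvd.1 (Nat.even_mul_pred_self n)) (by norm_num),
    Nat.cast_mul, Nat.cast_sub (by omega)]
  norm_num

lemma unifProb_small_dense_le {n N M : ℕ} (K : ℕ) (hN : n * (n - 1) / 2 = N) (hn : 2 ≤ n)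
    (hMN : M ≤ N) (hM : (M : ℝ) ≤ n * Real.log n) :
    unifProb (fun σ : Fin N ≃ {e : Sym2 (Fin n) // ¬ e.IsDiag} =>
        ∃ S : Finset (Fin n), S.card ≤ K ∧ S.card < (insideEdges S ∩ firstElems σ M).card)
      ≤ ∑ s ∈ Finset.range (K + 1), 2 ^ (s ^ 2) * 4 ^ (s + 1) * (Real.log n ^ (s + 1) / n) := by
  calc _ ≤ unifProb (fun σ : Fin N ≃ {e : Sym2 (Fin n) // ¬ e.IsDiag} =>
        ∃ s ∈ Finset.range (K + 1), ∃ S : Finset (Fin n), S.card = s ∧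
          s + 1 ≤ (insideEdges S ∩ firstElems σ M).card) := by
        refine unifProb_mono ?_
        rintro σ ⟨S, hS, hlt⟩
        exact ⟨_, Finset.mem_range_succ_iff.2 hS, S, rfl, hlt⟩
    _ ≤ _ := by
        refine (unifProb_exists_le _ _).trans (Finset.sum_le_sum fun s _ => ?_)
        exact (unifProb_exists_dense_le hN hMN s (s + 1)).trans
          (small_dense_bound hn (cast_half_mul_pred hN hn) hM)

lemma sum_pow_Icc_le {ρ : ℝ} (h0 : 0 ≤ ρ) (h1 : ρ ≤ 1 / 2) (n : ℕ) :
    ∑ s ∈ Finset.Icc 1 n, ρ ^ s ≤ 2 * ρ := by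
  have h : ∀ n : ℕ, ∑ s ∈ Finset.Icc 1 n, ρ ^ s ≤ 2 * ρ - 2 * ρ ^ (n + 1) := by
    intro n
    induction n with
    | zero => simp
    | succ n ih =>
      rw [Finset.sum_Icc_succ_top (by omega), pow_succ ρ (n + 1)]
      have := pow_nonneg h0 (n + 1)
      nlinarith
  linarith [h n, pow_nonneg h0 (n + 1)]

lemma unifProb_dense_le {n N M : ℕ} {δ : ℝ} (hδ : 0 < δ) (hN : n * (n - 1) / 2 = N)
    (hn : 2 ≤ n) (hMN : M ≤ N) (hM : (M : ℝ) ≤ n * Real.log n)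
    (hlarge : 4 * Real.exp 1 * Real.log n * (4 * (n : ℝ) ^ (-0.001 : ℝ)) ≤ 1)
    (hρ : Real.exp 1 * (4 * Real.exp 1 * Real.log n) ^ (1 + δ)
          * (4 * (n : ℝ) ^ (-0.001 : ℝ)) ^ δ ≤ 1 / 2) :
    unifProb (fun σ : Fin N ≃ {e : Sym2 (Fin n) // ¬ e.IsDiag} =>
        ∃ S : Finset (Fin n), 1 ≤ S.card ∧ (S.card : ℝ) ≤ 4 * (n : ℝ) ^ (0.999 : ℝ) ∧
          (1 + δ) * S.card < (insideEdges S ∩ firstElems σ M).card)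
      ≤ 2 * (Real.exp 1 * (4 * Real.exp 1 * Real.log n) ^ (1 + δ)
          * (4 * (n : ℝ) ^ (-0.001 : ℝ)) ^ δ) := by
  have hL : 0 ≤ Real.log n := Real.log_natCast_nonneg n
  calc _ ≤ unifProb (fun σ : Fin N ≃ {e : Sym2 (Fin n) // ¬ e.IsDiag} =>
        ∃ s ∈ (Finset.Icc 1 n).filter (fun s : ℕ => (s : ℝ) ≤ 4 * (n : ℝ) ^ (0.999 : ℝ)),
          ∃ S : Finset (Fin n), S.card = s ∧
            ⌊(1 + δ) * s⌋₊ + 1 ≤ (insideEdges S ∩ firstElems σ M).card) := by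
        refine unifProb_mono ?_
        rintro σ ⟨S, hS1, hS, hlt⟩
        refine ⟨S.card, Finset.mem_filter.2 ⟨Finset.mem_Icc.2 ⟨hS1, ?_⟩, hS⟩, S, rfl, ?_⟩
        · simpa using Finset.card_le_univ S
        · exact (Nat.floor_lt (by positivity)).2 hlt
    _ ≤ ∑ s ∈ (Finset.Icc 1 n).filter (fun s : ℕ => (s : ℝ) ≤ 4 * (n : ℝ) ^ (0.999 : ℝ)),
          (Real.exp 1 * (4 * Real.exp 1 * Real.log n) ^ (1 + δ)
          * (4 * (n : ℝ) ^ (-0.001 : ℝ)) ^ δ) ^ s := by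
        refine (unifProb_exists_le _ _).trans (Finset.sum_le_sum fun s hs => ?_)
        rw [Finset.mem_filter, Finset.mem_Icc] at hs
        refine (unifProb_exists_dense_le hN hMN s _).trans
          (dense_bound hδ hn (cast_half_mul_pred hN hn) hM hs.1.1 hs.2 ?_ hlarge)
        push_cast
        exact (Nat.lt_floor_add_one _).le
    _ ≤ _ := (Finset.sum_le_sum_of_subset_of_nonneg (Finset.filter_subset _ _)
          fun _ _ _ => by positivity).trans (sum_pow_Icc_le (by positivity) hρ n)

lemma unifProb_closed_connected_le {n N k i : ℕ} (hk : 2 ≤ k) (hN : n * (n - 1) / 2 = N)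
    (hn : 2 ≤ n) (hiN : i ≤ N) (hi : k ^ 99 * n ≤ i) :
    unifProb (fun σ : Fin N ≃ {e : Sym2 (Fin n) // ¬ e.IsDiag} =>
        ∃ S T : Finset (Fin n),
          (n : ℝ) ^ (0.99 : ℝ) ≤ (S.card : ℝ) ∧
          (S.card : ℝ) ≤ (n : ℝ) / (k : ℝ) ^ 3 ∧ T.card ≤ k * S.card ∧
          ((SimpleGraph.fromEdgeSet
              (↑(procEdges n N σ i) : Set (Sym2 (Fin n)))).induce
            (↑(S ∪ T) : Set (Fin n))).Connected ∧
          (↑T : Set (Fin n)) = {w : Fin n | w ∉ (↑S : Set (Fin n)) ∧ ∃ u ∈ S,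
            (SimpleGraph.fromEdgeSet
              (↑(procEdges n N σ i) : Set (Sym2 (Fin n)))).Adj u w})
      ≤ ((n : ℝ) + 1) * ((n + 1) * (n * Real.exp (-(n : ℝ) ^ (0.99 : ℝ)))) := by
  have hn0 : (0 : ℝ) < n := by positivity
  calc _ ≤ unifProb (fun σ : Fin N ≃ {e : Sym2 (Fin n) // ¬ e.IsDiag} =>
        ∃ s ∈ (Finset.range (n + 1)).filter (fun s : ℕ => (n : ℝ) ^ (0.99 : ℝ) ≤ s ∧
            (s : ℝ) ≤ n / (k : ℝ) ^ 3),
          ∃ m ∈ (Finset.range (n + 1)).filter (fun m : ℕ => s ≤ m ∧ m ≤ (k + 1) * s),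
            ∃ U : Finset (Fin n), U.card = m ∧ ∃ S ⊆ U, S.card = s ∧
              Disjoint (crossEdges S Uᶜ) (firstElems σ i) ∧
              ((SimpleGraph.fromEdgeSet (procEdges n N σ i : Set (Sym2 (Fin n)))).induce
                (U : Set (Fin n))).Connected) := by
        refine unifProb_mono ?_
        rintro σ ⟨S, T, hS1, hS2, hT, hcon, hTS⟩
        refine ⟨S.card, Finset.mem_filter.2 ⟨Finset.mem_range_succ_iff.2 ?_, hS1, hS2⟩,
          (S ∪ T).card, Finset.mem_filter.2 ⟨Finset.mem_range_succ_iff.2 ?_, ?_, ?_⟩,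
          S ∪ T, rfl, S, Finset.subset_union_left, rfl,
          disjoint_crossEdges_of_eq_neighborhood σ i S T hTS, hcon⟩
        · simpa using Finset.card_le_univ S
        · simpa using Finset.card_le_univ (S ∪ T)
        · exact Finset.card_le_card Finset.subset_union_left
        · have := Finset.card_union_le S T
          linarith
    _ ≤ (Finset.card ((Finset.range (n + 1)).filter (fun s : ℕ => (n : ℝ) ^ (0.99 : ℝ) ≤ s ∧
            (s : ℝ) ≤ n / (k : ℝ) ^ 3)) : ℝ) *
          ((n + 1) * (n * Real.exp (-(n : ℝ) ^ (0.99 : ℝ)))) := by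
        refine unifProb_exists_le_card_mul _ _ _ fun s hs => ?_
        rw [Finset.mem_filter] at hs
        refine (unifProb_exists_le_card_mul _ _ (n * Real.exp (-(n : ℝ) ^ (0.99 : ℝ)))
          fun m hm => ?_).trans ?_
        · rw [Finset.mem_filter] at hm
          refine (unifProb_exists_closed_connected_le hN hiN s m).trans ?_
          have hs1 : 1 ≤ s := by
            have : (0 : ℝ) < s := lt_of_lt_of_le (Real.rpow_pos_of_pos hn0 _) hs.2.1
            exact_mod_cast this
          refine (closed_connected_bound hk hn (cast_half_mul_pred hN hn) (by exact_mod_cast hi)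
            hs1 hs.2.2 hm.2.1 hm.2.2).trans ?_
          gcongr
          exact hs.2.1
        · gcongr
          refine (Nat.cast_le.2 (Finset.card_filter_le _ _)).trans ?_
          simp
    _ ≤ _ := by
        gcongr
        refine (Nat.cast_le.2 (Finset.card_filter_le _ _)).trans ?_
        simp

lemma unifProb_small_core_le {n N k i : ℕ} (hk : 2 ≤ k) (hN : n * (n - 1) / 2 = N)
    (hn : 8 * k ≤ n) (hiN : i ≤ N) (hi : k ^ 99 * n ≤ i) (hiL : (i : ℝ) ≤ n * Real.log n) :
    unifProb (fun σ : Fin N ≃ {e : Sym2 (Fin n) // ¬ e.IsDiag} =>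
        ¬ (1 - Real.exp (-(i : ℝ) / (40 * n))) * n <
          ((coreSet n (procEdges n N σ (i / 10)) (k + 1)).ncard : ℝ))
      ≤ Real.exp (-(n : ℝ) ^ (0.9 : ℝ)) := by
  have hn2 : 2 ≤ n := by omega
  have hn0 : (0 : ℝ) < n := by positivity
  have hn1 : (1 : ℝ) ≤ n := by exact_mod_cast (by omega : 1 ≤ n)
  set u := ⌈(n : ℝ) * Real.exp (-(i : ℝ) / (40 * n))⌉₊ with hu
  calc _ ≤ unifProb (fun σ : Fin N ≃ {e : Sym2 (Fin n) // ¬ e.IsDiag} =>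
        ∃ U : Finset (Fin n), U.card = u ∧
          (crossEdges U Uᶜ ∩ firstElems σ (i / 10)).card ≤ k * u) := by
        refine unifProb_mono fun σ hσ => ?_
        refine exists_sparse_cut_of_core_small σ (i / 10) k u ?_
        rw [not_lt] at hσ
        have hle : (coreSet n (procEdges n N σ (i / 10)) (k + 1)).ncard ≤ n := by
          simpa using Set.ncard_le_card (coreSet n (procEdges n N σ (i / 10)) (k + 1))
        have : u ≤ n - (coreSet n (procEdges n N σ (i / 10)) (k + 1)).ncard := by
          rw [hu, Nat.ceil_le, Nat.cast_sub hle]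
          linarith
        omega
    _ ≤ Real.exp (-u) :=
        (unifProb_exists_sparse_cut_le hN ((Nat.div_le_self i 10).trans hiN) u (k * u)).trans
          (sparse_cut_bound hk hn (cast_half_mul_pred hN hn2) (by exact_mod_cast hi) hu)
    _ ≤ _ := by
        gcongr
        refine le_trans ?_ (Nat.le_ceil _)
        calc (n : ℝ) ^ (0.9 : ℝ) ≤ (n : ℝ) ^ (1 + -(1 / 40) : ℝ) :=
              Real.rpow_le_rpow_of_exponent_le hn1 (by norm_num)
          _ = n * Real.exp (-(Real.log n / 40)) := by
              rw [Real.rpow_add hn0, Real.rpow_one, Real.rpow_def_of_pos hn0]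
              congr 2
              ring
          _ ≤ _ := by
              gcongr
              rw [neg_div, neg_le_neg_iff, div_le_div_iff₀ (by positivity) (by norm_num)]
              linarith

lemma tendsto_log_pow_div (r : ℕ) :
    Tendsto (fun n : ℕ => Real.log n ^ r / n) atTop (nhds 0) :=
  (Real.isLittleO_pow_log_id_atTop (n := r)).tendsto_div_nhds_zero.comp tendsto_natCast_atTop_atTop

lemma tendsto_small_dense_bound (K : ℕ) :
    Tendsto (fun n : ℕ => ∑ s ∈ Finset.range (K + 1),
      (2 : ℝ) ^ (s ^ 2) * 4 ^ (s + 1) * (Real.log n ^ (s + 1) / n)) atTop (nhds 0) := by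
  have h := tendsto_finsetSum (Finset.range (K + 1)) fun s _ =>
    (tendsto_log_pow_div (s + 1)).const_mul ((2 : ℝ) ^ (s ^ 2) * 4 ^ (s + 1))
  simpa using h

lemma tendsto_log_rpow_mul_rpow_neg (r : ℝ) {t : ℝ} (ht : 0 < t) :
    Tendsto (fun n : ℕ => Real.log n ^ r * (n : ℝ) ^ (-t)) atTop (nhds 0) := by
  have h := (isLittleO_log_rpow_rpow_atTop r ht).tendsto_div_nhds_zero.comp
    tendsto_natCast_atTop_atTop
  refine h.congr fun n => ?_
  simp only [Function.comp_apply]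
  rw [Real.rpow_neg (Nat.cast_nonneg n), div_eq_mul_inv]

lemma tendsto_dense_side :
    Tendsto (fun n : ℕ => 4 * Real.exp 1 * Real.log n * (4 * (n : ℝ) ^ (-0.001 : ℝ)))
      atTop (nhds 0) := by
  have h := (tendsto_log_rpow_mul_rpow_neg 1 (t := 0.001) (by norm_num)).const_mul
    (16 * Real.exp 1)
  rw [mul_zero] at h
  refine h.congr fun n => ?_
  rw [Real.rpow_one]
  ring

lemma tendsto_dense_bound {δ : ℝ} (hδ : 0 < δ) :
    Tendsto (fun n : ℕ => Real.exp 1 * (4 * Real.exp 1 * Real.log n) ^ (1 + δ)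
          * (4 * (n : ℝ) ^ (-0.001 : ℝ)) ^ δ) atTop (nhds 0) := by
  have h := (tendsto_log_rpow_mul_rpow_neg (1 + δ) (t := 0.001 * δ) (by positivity)).const_mul
    (Real.exp 1 * (4 * Real.exp 1) ^ (1 + δ) * 4 ^ δ)
  rw [mul_zero] at h
  refine h.congr fun n => ?_
  rw [Real.mul_rpow (by positivity) (Real.log_natCast_nonneg n),
    Real.mul_rpow (x := 4) (y := (n : ℝ) ^ (-0.001 : ℝ)) (by norm_num) (by positivity),
    ← Real.rpow_mul (Nat.cast_nonneg n), neg_mul]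
  ring

lemma tendsto_pow_mul_exp_neg_rpow :
    Tendsto (fun n : ℕ => (n : ℝ) ^ 5 * Real.exp (-(n : ℝ) ^ (0.9 : ℝ))) atTop (nhds 0) := by
  have h := (Real.tendsto_pow_mul_exp_neg_atTop_nhds_zero 6).comp
    ((tendsto_rpow_atTop (y := 0.9) (by norm_num)).comp tendsto_natCast_atTop_atTop)
  refine squeeze_zero' (Eventually.of_forall fun n => by positivity) ?_ h
  filter_upwards [eventually_ge_atTop 1] with n hn
  have hn1 : (1 : ℝ) ≤ n := by exact_mod_cast hn
  simp only [Function.comp_apply]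
  gcongr
  rw [← Real.rpow_natCast, ← Real.rpow_natCast, ← Real.rpow_mul (by positivity)]
  exact Real.rpow_le_rpow_of_exponent_le hn1 (by norm_num)

lemma eventually_floor_mul_log_le :
    ∀ᶠ n : ℕ in atTop, ⌊(n : ℝ) * Real.log n⌋₊ ≤ n * (n - 1) / 2 := by
  have h := tendsto_log_pow_div 1
  filter_upwards [h.eventually_le_const (show (0 : ℝ) < 1 / 4 by norm_num),
    eventually_ge_atTop 2] with n hn hn2
  have hn2' : (2 : ℝ) ≤ n := by exact_mod_cast hn2
  have hn0 : (0 : ℝ) < n := by linarith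
  rw [pow_one, div_le_iff₀ hn0] at hn
  have : (⌊(n : ℝ) * Real.log n⌋₊ : ℝ) ≤ ((n * (n - 1) / 2 : ℕ) : ℝ) := by
    refine (Nat.floor_le (by positivity)).trans ?_
    rw [cast_half_mul_pred rfl hn2]
    nlinarith
  exact_mod_cast this

lemma unifProb_le_one {Ω : Type*} [Finite Ω] (p : Ω → Prop) : unifProb p ≤ 1 :=
  div_le_one_of_le₀ (Nat.cast_le.2 (Finite.card_subtype_le p)) (Nat.cast_nonneg _)

lemma one_sub_unifProb_le {Ω : Type*} [Finite Ω] [Nonempty Ω] {p q : Ω → Prop}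
    (h : ∀ ω, ¬ p ω → q ω) : 1 - unifProb p ≤ unifProb q := by
  have h1 := unifProb_add_not p
  have h2 := unifProb_mono h
  linarith

/-- Fix `k ≥ 2`.  W.h.p., simultaneously for all `0 ≤ i ≤ n·log n` in the random
graph process: (i) every `S` with `|S| ≤ k^400` spans at most `|S|` edges of `F_i`;
(ii) every `S` with `k^200 ≤ |S| ≤ 4n^{0.999}` spans at most `(1+10^{−10})|S|` edges
of `F_i`; (iii) if `i ≥ k^99·n` there are no sets `S, T` with
`n^{0.99} ≤ |S| ≤ n/k³`, `|T| ≤ k|S|`, `S ∪ T` connected in `F_i` and `T = N(S)`;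
(iv) if `i ≥ k^99·n` the `(k+1)`-core of `F_{⌊i/10⌋}` has more than
`(1 − e^{−i/40n})·n` vertices. -/
theorem stmt_10 (k : ℕ) (hk : 2 ≤ k) :
    Tendsto (fun n : ℕ =>
      ((Nat.card {σ : Fin (n * (n - 1) / 2) ≃ {e : Sym2 (Fin n) // ¬ e.IsDiag} //
          ∀ i : ℕ, (i : ℝ) ≤ (n : ℝ) * Real.log n →
            ((∀ S : Finset (Fin n), S.card ≤ k ^ 400 →
                spanCount n (procEdges n (n * (n - 1) / 2) σ i) S ≤ S.card) ∧
            (∀ S : Finset (Fin n), k ^ 200 ≤ S.card →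
                (S.card : ℝ) ≤ 4 * (n : ℝ) ^ (0.999 : ℝ) →
                (spanCount n (procEdges n (n * (n - 1) / 2) σ i) S : ℝ) ≤
                  (1 + 1e-10) * (S.card : ℝ)) ∧
            (k ^ 99 * n ≤ i →
              ¬ ∃ S T : Finset (Fin n),
                (n : ℝ) ^ (0.99 : ℝ) ≤ (S.card : ℝ) ∧
                (S.card : ℝ) ≤ (n : ℝ) / (k : ℝ) ^ 3 ∧ T.card ≤ k * S.card ∧
                ((SimpleGraph.fromEdgeSet
                    (↑(procEdges n (n * (n - 1) / 2) σ i) : Set (Sym2 (Fin n)))).induce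
                  (↑(S ∪ T) : Set (Fin n))).Connected ∧
                (↑T : Set (Fin n)) = {w : Fin n | w ∉ (↑S : Set (Fin n)) ∧ ∃ u ∈ S,
                  (SimpleGraph.fromEdgeSet
                    (↑(procEdges n (n * (n - 1) / 2) σ i) : Set (Sym2 (Fin n)))).Adj u w}) ∧
            (k ^ 99 * n ≤ i →
              (1 - Real.exp (-(i : ℝ) / (40 * n))) * n <
                ((coreSet n (procEdges n (n * (n - 1) / 2) σ (i / 10)) (k + 1)).ncard : ℝ)))} : ℝ) /
        (Nat.card (Fin (n * (n - 1) / 2) ≃ {e : Sym2 (Fin n) // ¬ e.IsDiag}) : ℝ)))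
      atTop (nhds 1) := by
  set δ : ℝ := 1e-10 with hδ
  have hδ0 : 0 < δ := by rw [hδ]; norm_num
  set ρ : ℕ → ℝ := fun n => Real.exp 1 * (4 * Real.exp 1 * Real.log n) ^ (1 + δ)
          * (4 * (n : ℝ) ^ (-0.001 : ℝ)) ^ δ with hρ
  set ε : ℕ → ℝ := fun n => ∑ s ∈ Finset.range (k ^ 400 + 1),
      (2 : ℝ) ^ (s ^ 2) * 4 ^ (s + 1) * (Real.log n ^ (s + 1) / n) with hε
  set η : ℕ → ℝ := fun n => (n : ℝ) ^ 5 * Real.exp (-(n : ℝ) ^ (0.9 : ℝ)) with hη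
  have hlim : Tendsto (fun n => 1 - (ε n + 2 * ρ n + 5 * η n)) atTop (nhds 1) := by
    have h := ((tendsto_small_dense_bound (k ^ 400)).add
      ((tendsto_dense_bound hδ0).const_mul 2)).add (tendsto_pow_mul_exp_neg_rpow.const_mul 5)
    simpa using h.const_sub 1
  refine tendsto_of_tendsto_of_tendsto_of_le_of_le' hlim tendsto_const_nhds ?_
    (Eventually.of_forall fun n => unifProb_le_one _)
  filter_upwards [eventually_floor_mul_log_le, eventually_ge_atTop (8 * k),
    tendsto_dense_side.eventually_le_const (show (0 : ℝ) < 1 by norm_num),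
    (tendsto_dense_bound hδ0).eventually_le_const (show (0 : ℝ) < 1 / 2 by norm_num)]
    with n hMN hnk hside hρn
  have hn2 : 2 ≤ n := by omega
  have hn1 : (1 : ℝ) ≤ n := by exact_mod_cast (by omega : 1 ≤ n)
  have hn0 : (0 : ℝ) < n := by linarith
  have hNL : (0 : ℝ) ≤ n * Real.log n := mul_nonneg hn0.le (Real.log_natCast_nonneg n)
  obtain ⟨N, hN⟩ : ∃ N, n * (n - 1) / 2 = N := ⟨_, rfl⟩
  set M := ⌊(n : ℝ) * Real.log n⌋₊ with hM
  have hML : (M : ℝ) ≤ n * Real.log n := Nat.floor_le hNL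
  rw [hN] at hMN ⊢
  have hcard : Fintype.card {e : Sym2 (Fin n) // ¬ e.IsDiag} = N := (card_nondiag_fin n).trans hN
  have : Nonempty (Fin N ≃ {e : Sym2 (Fin n) // ¬ e.IsDiag}) :=
    ⟨(Fintype.equivFinOfCardEq hcard).symm⟩
  set I := (Finset.range (M + 1)).filter (fun i => k ^ 99 * n ≤ i) with hI
  have hIcard : (I.card : ℝ) ≤ n ^ 2 := by
    have h1 : I.card ≤ M + 1 := (Finset.card_filter_le _ _).trans (by simp)
    have h2 : (I.card : ℝ) ≤ M + 1 := by exact_mod_cast h1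
    have h3 := Real.log_le_sub_one_of_pos hn0
    nlinarith
  have h1 := unifProb_small_dense_le (k ^ 400) hN hn2 hMN hML
  have h2 := unifProb_dense_le hδ0 hN hn2 hMN hML hside hρn
  have hIi : ∀ i ∈ I, i ≤ M ∧ k ^ 99 * n ≤ i := by
    intro i hi
    rw [hI, Finset.mem_filter, Finset.mem_range_succ_iff] at hi
    exact hi
  have h3 := unifProb_exists_le_card_mul I _ _ fun i hi =>
    unifProb_closed_connected_le hk hN hn2 ((hIi i hi).1.trans hMN) (hIi i hi).2
  have h4 := unifProb_exists_le_card_mul I _ _ fun i hi =>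
    unifProb_small_core_le hk hN hnk ((hIi i hi).1.trans hMN) (hIi i hi).2
      ((Nat.cast_le.2 (hIi i hi).1).trans hML)
  have h3' : (I.card : ℝ) * (((n : ℝ) + 1) * ((n + 1) *
      (n * Real.exp (-(n : ℝ) ^ (0.99 : ℝ))))) ≤ 4 * η n := by
    calc _ ≤ (n : ℝ) ^ 2 * ((2 * n) * ((2 * n) * (n * Real.exp (-(n : ℝ) ^ (0.9 : ℝ))))) := by
          gcongr
          · linarith
          · linarith
          · norm_num
      _ = 4 * η n := by rw [hη]; ring
  have h4' : (I.card : ℝ) * Real.exp (-(n : ℝ) ^ (0.9 : ℝ)) ≤ η n := by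
    exact mul_le_mul_of_nonneg_right (hIcard.trans (pow_le_pow_right₀ hn1 (by norm_num)))
      (Real.exp_pos _).le
  have hbad := (unifProb_or_le _ _).trans (add_le_add
    ((unifProb_or_le _ _).trans (add_le_add ((unifProb_or_le _ _).trans (add_le_add h1 h2))
      (h3.trans h3'))) (h4.trans h4'))
  change _ ≤ unifProb _
  refine le_trans ?_ ((sub_le_sub_left hbad 1).trans (one_sub_unifProb_le ?_))
  · change 1 - (ε n + 2 * ρ n + 5 * η n) ≤ 1 - (ε n + 2 * ρ n + 4 * η n + η n)
    linarith
  · intro σ hσ i hi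
    have hiM : i ≤ M := Nat.le_floor hi
    have hmono : ∀ S : Finset (Fin n), spanCount n (procEdges n N σ i) S
        ≤ (insideEdges S ∩ firstElems σ M).card := by
      intro S
      rw [spanCount_procEdges]
      exact Finset.card_le_card (Finset.inter_subset_inter_left (firstElems_mono σ hiM))
    refine ⟨fun S hS => ?_, fun S hS hSn => ?_, fun hki hST => ?_, fun hki => ?_⟩
    · by_contra hlt
      rw [not_le] at hlt
      exact hσ (Or.inl (Or.inl (Or.inl ⟨S, hS, hlt.trans_le (hmono S)⟩)))
    · by_contra hlt
      rw [not_le] at hlt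
      refine hσ (Or.inl (Or.inl (Or.inr ⟨S, ?_, hSn, hlt.trans_le (Nat.cast_le.2 (hmono S))⟩)))
      exact (Nat.one_le_pow _ _ (by omega)).trans hS
    · exact hσ (Or.inl (Or.inr ⟨i, Finset.mem_filter.2 ⟨Finset.mem_range_succ_iff.2 hiM, hki⟩,
        hST⟩))
    · by_contra hlt
      exact hσ (Or.inr ⟨i, Finset.mem_filter.2 ⟨Finset.mem_range_succ_iff.2 hiM, hki⟩, hlt⟩)
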